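/- The number of nonempty partition diagrams of order n that have no separation (equivalently, are ⊗-irreducible), for n = 1,2,3,4, is 2, 11, 151, 3267 respectively. -/

import Mathlib

open Finset

/-- A partition diagram of order `k`: a set partition (equivalence relation) on the
`2k`-element set `Fin k × Bool`, where `(i, true)` denotes the top node `i+1` and
`(i, false)` denotes the bottom node `(i+1)'`. -/
abbrev DiagramOn (k : ℕ) := Setoid (Fin k × Bool)

/-- A partition diagram of arbitrary order. -/
abbrev Diagram := Σ k : ℕ, DiagramOn k

/-- The disjoint sum of two set partitions. -/
def sumSetoid {α β : Type*} (s : Setoid α) (t : Setoid β) : Setoid (α ⊕ β) where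
  r x y :=
    match x, y with
    | .inl a, .inl b => s.r a b
    | .inr a, .inr b => t.r a b
    | _, _ => False
  iseqv := by
    refine ⟨?_, ?_, ?_⟩
    · rintro (a | a)
      · exact s.iseqv.refl a
      · exact t.iseqv.refl a
    · rintro (a | a) (b | b) h
      · exact s.iseqv.symm h
      · exact h.elim
      · exact h.elim
      · exact t.iseqv.symm h
    · rintro (a | a) (b | b) (c | c) h₁ h₂ <;>
        first
          | exact s.iseqv.trans h₁ h₂
          | exact t.iseqv.trans h₁ h₂
          | exact h₁.elim
          | exact h₂.elim

/-- The relabeling identifying the nodes of two concatenated diagrams of orders `j`, `m`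
with the nodes of a diagram of order `j + m`. -/
def concatEquiv (j m : ℕ) : (Fin j × Bool) ⊕ (Fin m × Bool) ≃ Fin (j + m) × Bool :=
  (Equiv.sumProdDistrib (Fin j) (Fin m) Bool).symm.trans
    (Equiv.prodCongr finSumFinEquiv (Equiv.refl Bool))

/-- Horizontal concatenation of partition diagrams. -/
def concatOn {j m : ℕ} (s : DiagramOn j) (t : DiagramOn m) : DiagramOn (j + m) :=
  Setoid.comap (concatEquiv j m).symm (sumSetoid s t)

/-- Horizontal concatenation `⊗` of diagrams of arbitrary orders. -/
def Diagram.concat (d₁ d₂ : Diagram) : Diagram :=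
  ⟨d₁.1 + d₂.1, concatOn d₁.2 d₂.2⟩

/-- A nonempty diagram is `⊗`-irreducible if it is not the concatenation of two
nonempty diagrams. -/
def Diagram.Irr (d : Diagram) : Prop :=
  d.1 ≠ 0 ∧ ¬ ∃ d₁ d₂ : Diagram, d₁.1 ≠ 0 ∧ d₂.1 ≠ 0 ∧ d = d₁.concat d₂

/-- The Bell number: the number of set partitions of an `m`-element set. -/
noncomputable def bell (m : ℕ) : ℕ := Nat.card (Setoid (Fin m))

/-- The smallest equivalence relation containing `s` and relating `a` with `b`
(merging the blocks of `a` and `b`). -/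
def joinTwo {X : Type*} (s : Setoid X) (a b : X) : Setoid X :=
  s ⊔ Relation.EqvGen.setoid (fun x y => x = a ∧ y = b)

/-- The near-concatenation `•` of partition diagrams: concatenate, then merge the block
of the bottom-right node of the first diagram with the block of the bottom-left node of
the second diagram.  By convention `∅ • ρ = ρ` and `π • ∅ = π`. -/
def Diagram.bullet (d₁ d₂ : Diagram) : Diagram :=
  if h₁ : d₁.1 = 0 then d₂
  else if h₂ : d₂.1 = 0 then d₁
  else ⟨d₁.1 + d₂.1,
    joinTwo (concatOn d₁.2 d₂.2)
      (⟨d₁.1 - 1, by omega⟩, false) (⟨d₁.1, by omega⟩, false)⟩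

/-- The `⊗`-product of a list of diagrams (empty diagram for the empty list). -/
def Diagram.listConcat : List Diagram → Diagram
  | [] => ⟨0, ⊥⟩
  | d :: l => l.foldl Diagram.concat d

/-- The `•`-product of a list of diagrams (empty diagram for the empty list). -/
def Diagram.listBullet : List Diagram → Diagram
  | [] => ⟨0, ⊥⟩
  | d :: l => l.foldl Diagram.bullet d

/-- The number of `⊗`-irreducible partition diagrams of order `k`. -/
noncomputable def irrCount (k : ℕ) : ℕ := Nat.card {s : DiagramOn k // Diagram.Irr ⟨k, s⟩}

/-- A diagram of order `k` has a separation at `j` (with `0 < j < k`) if every block lies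
entirely among the first `j` columns or entirely among the remaining columns. -/
def HasSep {k : ℕ} (s : DiagramOn k) (j : ℕ) : Prop :=
  ∀ x y : Fin k × Bool, s.r x y → ((x.1 : ℕ) < j ↔ (y.1 : ℕ) < j)

/-- The number of partition diagrams of order `n` with no separation. -/
noncomputable def noSepCount (n : ℕ) : ℕ :=
  Nat.card {s : DiagramOn n // ¬ ∃ j, 0 < j ∧ j < n ∧ HasSep s j}

namespace NoSepAux

/-- Lists `[f 0, ..., f (n-1)]` of maps sending each point to the least element of its block. -/
def gen : ℕ → List (List ℕ)
  | 0 => [[]]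
  | n + 1 => (gen n).flatMap fun l =>
      ((List.range (n + 1)).filter fun c => c == n || l.getD c 0 == c).map fun c => l ++ [c]

def Good (n : ℕ) (f : ℕ → ℕ) : Prop := ∀ i < n, f i ≤ i ∧ f (f i) = f i

lemma getD_map (n : ℕ) (f : ℕ → ℕ) (i : ℕ) (h : i < n) :
    ((List.range n).map f).getD i 0 = f i := by
  simp [List.getD, h]

lemma map_mem_gen (n : ℕ) (f : ℕ → ℕ) (hf : Good n f) : (List.range n).map f ∈ gen n := by
  induction n with
  | zero => simp [gen]
  | succ n ih =>
    simp only [gen, List.mem_flatMap, List.mem_map, List.mem_filter, List.mem_range]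
    refine ⟨_, ih fun i hi => hf i (by omega), f n, ⟨?_, ?_⟩, ?_⟩
    · have := (hf n (by omega)).1
      omega
    · have h := hf n (by omega)
      by_cases hn : f n = n
      · simp [hn]
      · rw [getD_map _ _ _ (by omega)]
        simp [h.2]
    · simp [List.range_succ]

lemma exists_of_mem_gen (n : ℕ) : ∀ l ∈ gen n, ∃ f, Good n f ∧ l = (List.range n).map f := by
  induction n with
  | zero =>
    intro l hl
    refine ⟨id, fun i hi => by omega, ?_⟩
    simpa [gen] using hl
  | succ n ih =>
    intro l hl
    simp only [gen, List.mem_flatMap, List.mem_map, List.mem_filter, List.mem_range] at hl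
    obtain ⟨l', hl', c, ⟨hc, hc'⟩, rfl⟩ := hl
    obtain ⟨f, hf, rfl⟩ := ih l' hl'
    refine ⟨fun i => if i = n then c else f i, ?_, ?_⟩
    · intro i hi
      by_cases hin : i = n
      · subst hin
        by_cases hci : c = i
        · simp [hci]
        · rw [getD_map _ _ _ (by omega)] at hc'
          simp [hci] at hc'
          simp [hci, hc']
          omega
      · have h := hf i (by omega)
        have : f i ≠ n := by omega
        simp [hin, this, h]
    · rw [List.range_succ, List.map_append]
      congr 1
      · apply List.map_congr_left
        intro a ha
        rw [List.mem_range] at ha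
        simp [show a ≠ n by omega]
      · simp

lemma gen_nodup (n : ℕ) : (gen n).Nodup := by
  induction n with
  | zero => simp [gen]
  | succ n ih =>
    rw [gen, List.nodup_flatMap]
    refine ⟨fun l _ => ?_, ?_⟩
    · refine List.Nodup.map ?_ (List.nodup_range.filter _)
      intro a b h
      simpa using h
    · refine List.Pairwise.imp ?_ ih
      intro a b hab x hx hy
      simp only [List.mem_map] at hx hy
      obtain ⟨c, _, rfl⟩ := hx
      obtain ⟨d, _, h⟩ := hy
      exact hab (List.append_inj_left' h rfl).symm

def dec (k : ℕ) [NeZero k] (i : ℕ) : Fin k × Bool := (Fin.ofNat k (i / 2), i % 2 == 1)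

def enc {k : ℕ} (x : Fin k × Bool) : ℕ := 2 * x.1.val + x.2.toNat

lemma enc_lt {k : ℕ} (x : Fin k × Bool) : enc x < 2 * k := by
  rcases x with ⟨i, _ | _⟩ <;> simp [enc] <;> omega

lemma enc_div {k : ℕ} (x : Fin k × Bool) : enc x / 2 = x.1.val := by
  rcases x with ⟨i, _ | _⟩ <;> simp [enc] <;> omega

lemma dec_enc {k : ℕ} [NeZero k] (x : Fin k × Bool) : dec k (enc x) = x := by
  rcases x with ⟨i, b⟩
  ext
  · simp [dec, enc_div]
  · cases b <;> simp [dec, enc]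

lemma enc_dec {k : ℕ} [NeZero k] (i : ℕ) (h : i < 2 * k) : enc (dec k i) = i := by
  have h2 : i / 2 % k = i / 2 := Nat.mod_eq_of_lt (by omega)
  rcases Nat.mod_two_eq_zero_or_one i with h1 | h1 <;> simp [enc, dec, h1, h2] <;> omega

lemma dec_fst {k : ℕ} [NeZero k] (i : ℕ) (h : i < 2 * k) : ((dec k i).1 : ℕ) = i / 2 := by
  simp [dec]
  exact Nat.mod_eq_of_lt (by omega)

/-- The least element of the block of `i`. -/
noncomputable def mn {k : ℕ} [NeZero k] (s : DiagramOn k) (i : ℕ) : ℕ :=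
  sInf {j | j < 2 * k ∧ s.r (dec k j) (dec k i)}

variable {k : ℕ} [NeZero k]

lemma mn_le (s : DiagramOn k) (i j : ℕ) (hj : j < 2 * k) (h : s.r (dec k j) (dec k i)) :
    mn s i ≤ j := Nat.sInf_le ⟨hj, h⟩

lemma mn_mem (s : DiagramOn k) (i : ℕ) (hi : i < 2 * k) :
    mn s i < 2 * k ∧ s.r (dec k (mn s i)) (dec k i) :=
  Nat.sInf_mem (s := {j | j < 2 * k ∧ s.r (dec k j) (dec k i)}) ⟨i, hi, s.iseqv.refl _⟩

lemma mn_congr (s : DiagramOn k) (i j : ℕ) (h : s.r (dec k i) (dec k j)) : mn s i = mn s j := by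
  unfold mn
  congr 1
  ext a
  exact and_congr_right fun _ => ⟨fun h' => s.iseqv.trans h' h,
    fun h' => s.iseqv.trans h' (s.iseqv.symm h)⟩

lemma mn_good (s : DiagramOn k) : Good (2 * k) (mn s) := fun i hi =>
  ⟨mn_le s i i hi (s.iseqv.refl _), mn_congr s _ _ (mn_mem s i hi).2⟩

lemma rel_iff (s : DiagramOn k) (x y : Fin k × Bool) :
    s.r x y ↔ mn s (enc x) = mn s (enc y) := by
  constructor
  · intro h
    apply mn_congr
    rwa [dec_enc, dec_enc]
  · intro h
    have h1 := (mn_mem s _ (enc_lt x)).2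
    have h2 := (mn_mem s _ (enc_lt y)).2
    rw [dec_enc] at h1 h2
    rw [h] at h1
    exact s.iseqv.trans (s.iseqv.symm h1) h2

lemma hasSep_iff (s : DiagramOn k) (j : ℕ) :
    HasSep s j ↔ ∀ i < 2 * k, ¬ (2 * j ≤ i ∧ mn s i < 2 * j) := by
  constructor
  · rintro h i hi ⟨h1, h2⟩
    have hm := mn_mem s i hi
    have := h _ _ hm.2
    rw [dec_fst _ hi, dec_fst _ hm.1] at this
    omega
  · intro h x y hxy
    rw [rel_iff] at hxy
    have hx := h _ (enc_lt x)
    have hy := h _ (enc_lt y)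
    have gx := (mn_good s _ (enc_lt x)).1
    have gy := (mn_good s _ (enc_lt y)).1
    rw [← enc_div x, ← enc_div y]
    omega

def noSepBool (k : ℕ) (l : List ℕ) : Bool :=
  (List.range k).all fun j => j == 0 ||
    (List.range (2 * k)).any fun i => Nat.ble (2 * j) i && Nat.blt (l.getD i 0) (2 * j)

lemma noSepBool_iff (s : DiagramOn k) :
    noSepBool k ((List.range (2 * k)).map (mn s)) = true ↔ ¬ ∃ j, 0 < j ∧ j < k ∧ HasSep s j := by
  simp only [noSepBool, List.all_eq_true, List.any_eq_true, List.mem_range, Bool.or_eq_true,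
    Bool.and_eq_true, beq_iff_eq, Nat.ble_eq, Nat.blt_eq, hasSep_iff]
  push Not
  refine forall_congr' fun j => ⟨fun h h0 hk => ?_, fun h hk => ?_⟩
  · rcases h hk with h | ⟨i, hi, h1, h2⟩
    · omega
    · rw [getD_map _ _ _ hi] at h2
      exact ⟨i, hi, h1, h2⟩
  · by_cases h0 : j = 0
    · exact Or.inl h0
    · obtain ⟨i, hi, h1, h2⟩ := h (by omega) hk
      refine Or.inr ⟨i, hi, h1, ?_⟩
      rwa [getD_map _ _ _ hi]

lemma mn_ker (f : ℕ → ℕ) (hf : Good (2 * k) f) (i : ℕ) (hi : i < 2 * k) :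
    mn (Setoid.ker fun x : Fin k × Bool => f (enc x)) i = f i := by
  have h := hf i hi
  apply le_antisymm
  · apply mn_le
    · omega
    · change f (enc _) = f (enc _)
      rw [enc_dec _ hi, enc_dec _ (by omega), h.2]
  · obtain ⟨h1, h2⟩ := mn_mem (Setoid.ker fun x : Fin k × Bool => f (enc x)) i hi
    change f (enc _) = f (enc _) at h2
    rw [enc_dec _ hi, enc_dec _ h1] at h2
    rw [← h2]
    exact (hf _ h1).1

lemma count_eq : noSepCount k = ((gen (2 * k)).filter (noSepBool k)).length := by
  have hnd : ((gen (2 * k)).filter (noSepBool k)).Nodup := (gen_nodup _).filter _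
  rw [← List.toFinset_card_of_nodup hnd, ← Nat.card_eq_finsetCard]
  refine Nat.card_congr (Equiv.ofBijective (fun s => ⟨(List.range (2 * k)).map (mn s.1), ?_⟩) ⟨?_, ?_⟩)
  · rw [List.mem_toFinset, List.mem_filter]
    exact ⟨map_mem_gen _ _ (mn_good _), (noSepBool_iff _).2 s.2⟩
  · rintro ⟨s, hs⟩ ⟨t, ht⟩ h
    simp only [Subtype.mk.injEq, List.map_inj_left, List.mem_range] at h
    apply Subtype.ext
    apply Setoid.ext
    intro x y
    change s.r x y ↔ t.r x y
    rw [rel_iff, rel_iff, h _ (enc_lt x), h _ (enc_lt y)]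
  · rintro ⟨l, hl⟩
    rw [List.mem_toFinset, List.mem_filter] at hl
    obtain ⟨f, hf, rfl⟩ := exists_of_mem_gen _ _ hl.1
    have key : (List.range (2 * k)).map (mn (Setoid.ker fun x : Fin k × Bool => f (enc x))) =
        (List.range (2 * k)).map f :=
      List.map_congr_left fun i hi => mn_ker f hf i (List.mem_range.1 hi)
    refine ⟨⟨Setoid.ker fun x : Fin k × Bool => f (enc x), ?_⟩, Subtype.ext key⟩
    rw [← noSepBool_iff, key]
    exact hl.2

/-- Depth-first count of the extensions (by `m` more entries) of a list of length `n`
which pass the test `p`. -/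
def cnt (p : List ℕ → Bool) : ℕ → ℕ → List ℕ → ℕ
  | 0, _, l => (p l).toNat
  | m + 1, n, l =>
      (((List.range (n + 1)).filter fun c => c == n || l.getD c 0 == c).map
        fun c => cnt p m (n + 1) (l ++ [c])).sum

lemma length_filter_eq (p : List ℕ → Bool) (L : List (List ℕ)) :
    (L.filter p).length = (L.map fun l => (p l).toNat).sum := by
  induction L with
  | nil => rfl
  | cons a L ih =>
    cases h : p a <;> simp [h, ih]
    omega

lemma cnt_gen (p : List ℕ → Bool) (m : ℕ) : ∀ n,
    ((gen (m + n)).filter p).length = ((gen n).map (cnt p m n)).sum := by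
  induction m with
  | zero =>
    intro n
    rw [Nat.zero_add, length_filter_eq]
    rfl
  | succ m ih =>
    intro n
    rw [show m + 1 + n = m + (n + 1) by omega, ih (n + 1), gen]
    generalize gen n = L
    induction L with
    | nil => rfl
    | cons a L ihL =>
      rw [List.flatMap_cons, List.map_append, List.sum_append, ihL, List.map_cons, List.sum_cons,
        List.map_map]
      rfl

lemma count_eq_cnt : noSepCount k = cnt (noSepBool k) (2 * k) 0 [] := by
  rw [count_eq]
  have h := cnt_gen (noSepBool k) (2 * k) 0
  rw [Nat.add_zero] at h
  rw [h]
  simp [gen]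

/-- Is one of the first `m` entries smaller than `b`? -/
def anyLt (b : ℕ) : ℕ → List ℕ → Bool
  | 0, _ => false
  | _ + 1, [] => false
  | m + 1, a :: t => match Nat.ble b a with
      | true => anyLt b m t
      | false => true

lemma anyLt_iff (b m : ℕ) (l : List ℕ) :
    anyLt b m l = true ↔ ∃ i, ∃ h : i < l.length, i < m ∧ l[i] < b := by
  induction m generalizing l with
  | zero => simp [anyLt]
  | succ m ih =>
    cases l with
    | nil => simp [anyLt]
    | cons a t =>
      rw [anyLt]
      cases h : Nat.ble b a
      · have h' : a < b := by
          by_contra hc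
          rw [Nat.ble_eq_true_of_le (not_lt.1 hc)] at h
          exact absurd h (by simp)
        simp only [true_iff]
        exact ⟨0, by simp, by omega, by simpa using h'⟩
      · have h' : b ≤ a := Nat.le_of_ble_eq_true h
        simp only [ih]
        constructor
        · rintro ⟨i, hi, him, hlt⟩
          exact ⟨i + 1, by simpa using hi, by omega, by simpa using hlt⟩
        · rintro ⟨i, hi, him, hlt⟩
          cases i with
          | zero =>
            simp at hlt
            omega
          | succ i => exact ⟨i, by simpa using hi, by omega, by simpa using hlt⟩

/-- The test for separations at `1, ..., j` on reversed lists. -/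
def revTest (k : ℕ) : ℕ → List ℕ → ℕ
  | 0, _ => 1
  | j + 1, l => match anyLt (2 * (j + 1)) (2 * (k - (j + 1))) l with
      | false => 0
      | true => revTest k j l

lemma revTest_eq (k j : ℕ) (l : List ℕ) :
    revTest k j l =
      ((List.range (j + 1)).all fun i => i == 0 || anyLt (2 * i) (2 * (k - i)) l).toNat := by
  induction j with
  | zero => simp [revTest]
  | succ j ih =>
    rw [revTest, List.range_succ, List.all_append, ih]
    cases h : anyLt (2 * (j + 1)) (2 * (k - (j + 1))) l <;> simp [h]

lemma anyLt_reverse (k j : ℕ) (hj : j < k) (l : List ℕ) (hl : l.length = 2 * k) :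
    anyLt (2 * j) (2 * (k - j)) l.reverse =
      (List.range (2 * k)).any fun i => Nat.ble (2 * j) i && Nat.blt (l.getD i 0) (2 * j) := by
  rw [Bool.eq_iff_iff, anyLt_iff]
  simp only [List.any_eq_true, List.mem_range, Bool.and_eq_true, Nat.ble_eq, Nat.blt_eq]
  constructor
  · rintro ⟨i, hi, him, hlt⟩
    rw [List.length_reverse] at hi
    rw [List.getElem_reverse] at hlt
    refine ⟨l.length - 1 - i, by omega, by omega, ?_⟩
    rwa [List.getD_eq_getElem _ _ (by omega)]
  · rintro ⟨i, hi, him, hlt⟩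
    rw [List.getD_eq_getElem _ _ (by omega)] at hlt
    refine ⟨l.length - 1 - i, by rw [List.length_reverse]; omega, by omega, ?_⟩
    rw [List.getElem_reverse]
    convert hlt using 2
    omega

lemma revTest_reverse (k : ℕ) (hk : 0 < k) (l : List ℕ) (hl : l.length = 2 * k) :
    revTest k (k - 1) l.reverse = (noSepBool k l).toNat := by
  rw [revTest_eq, noSepBool, Nat.sub_add_cancel hk]
  congr 1
  rw [Bool.eq_iff_iff, List.all_eq_true, List.all_eq_true]
  refine forall_congr' fun j => forall_congr' fun hj => ?_
  rw [anyLt_reverse k j (List.mem_range.1 hj) l hl]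

def addAll (f : ℕ → ℕ) : List ℕ → ℕ
  | [] => 0
  | a :: t => f a + addAll f t

lemma addAll_eq (f : ℕ → ℕ) (l : List ℕ) : addAll f l = (l.map f).sum := by
  induction l with
  | nil => rfl
  | cons a t ih => simp [addAll, ih]

/-- Version of `cnt` on reversed lists which keeps track of the block minima in `r`. -/
def cntR (q : List ℕ → ℕ) : ℕ → ℕ → List ℕ → List ℕ → ℕ
  | 0, _, _, l => q l
  | m + 1, n, r, l =>
      cntR q m (n + 1) (n :: r) (n :: l) + addAll (fun c => cntR q m (n + 1) r (c :: l)) r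

def reps (n : ℕ) (l : List ℕ) : List ℕ := (List.range n).filter fun c => l.getD c 0 == c

lemma reps_append (n c : ℕ) (l : List ℕ) (hl : l.length = n) :
    reps (n + 1) (l ++ [c]) = reps n l ++ if c = n then [n] else [] := by
  rw [reps, List.range_succ, List.filter_append]
  congr 1
  · apply List.filter_congr
    intro i hi
    rw [List.mem_range] at hi
    rw [List.getD_append _ _ _ _ (by omega)]
  · subst hl
    by_cases h : c = l.length <;> simp [h]

lemma cnt_eq_cntR (p : List ℕ → Bool) (q : List ℕ → ℕ) (N : ℕ)
    (hpq : ∀ l : List ℕ, l.length = N → q l.reverse = (p l).toNat) (m : ℕ) :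
    ∀ (n : ℕ) (l r : List ℕ), m + n = N → l.length = n → r.Perm (reps n l) →
      cnt p m n l = cntR q m n r l.reverse := by
  induction m with
  | zero =>
    intro n l r hN hl _
    rw [cnt, cntR, hpq l (by omega)]
  | succ m ih =>
    intro n l r hN hl hr
    have hc : ((List.range (n + 1)).filter fun c => c == n || l.getD c 0 == c) =
        reps n l ++ [n] := by
      rw [List.range_succ, List.filter_append]
      congr 1
      · apply List.filter_congr
        intro i hi
        rw [List.mem_range] at hi
        simp [show i ≠ n by omega]
      · simp
    rw [cnt, hc, cntR, addAll_eq, List.map_append, List.sum_append, add_comm]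
    congr 1
    · rw [List.map_singleton, List.sum_singleton, ih (n + 1) (l ++ [n]) (n :: r) (by omega)
        (by simp [hl]) ?_, List.reverse_append]
      · rfl
      · rw [reps_append n n l hl, if_pos rfl]
        exact (hr.cons n).trans (List.perm_append_singleton n _).symm
    · rw [(hr.map _).sum_eq]
      congr 1
      apply List.map_congr_left
      intro c hcm
      have hcn : c < n := List.mem_range.1 (List.mem_filter.1 hcm).1
      rw [ih (n + 1) (l ++ [c]) r (by omega) (by simp [hl]) ?_, List.reverse_append]
      · rfl
      · rw [reps_append n c l hl, if_neg (by omega), List.append_nil]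
        exact hr

lemma count_eq_cntR : noSepCount k = cntR (revTest k (k - 1)) (2 * k) 0 [] [] := by
  rw [count_eq_cnt]
  exact cnt_eq_cntR _ _ (2 * k) (revTest_reverse k (NeZero.pos k)) (2 * k) 0 [] [] rfl rfl
    (List.Perm.refl _)

end NoSepAux

/-- The number of diagrams of order `n = 1, 2, 3, 4` with no separation
(equivalently, `⊗`-irreducible) is `2, 11, 151, 3267` respectively. -/
theorem noSepCount_values :
    noSepCount 1 = 2 ∧ noSepCount 2 = 11 ∧ noSepCount 3 = 151 ∧ noSepCount 4 = 3267 := by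
  refine ⟨?_, ?_, ?_, ?_⟩ <;> rw [NoSepAux.count_eq_cntR] <;> decide +kernel
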